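/- Let P, P′ ∈ Π(ω) be two acyclic reduced pipe dreams related by the flip of a contact between their pipes i and j. Then every directed path between i and j (in either direction) in the contact graph P♯, and every directed path between i and j in P′♯, consists of a single arc. -/

import Mathlib

/-- A pipe dream of size `n` on the triangular shape, with boxes indexed by pairs
`(r, c)` of a row `r` and a column `c`, both `0`-indexed (rows increase southwards,
columns increase eastwards).  `cross r c = true` means that box `(r, c)` contains a
crossing tile; all other boxes contain elbow tiles.  Crossings are only allowed in
the full boxes of the triangular shape, i.e. those with `r + c + 2 ≤ n` (the boxes
with `r + c + 1 = n` are the half-boxes on the antidiagonal, which are forced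
elbows).  The `n` pipes enter horizontally on the left side in rows `0, …, n-1` and
exit vertically on the top side in columns `0, …, n-1`; pipe `k` is the pipe
entering at row `k`.  An elbow tile connects the west edge of its box to the north
edge (the pipe travelling through this elbow passes northwest of the tile) and the
south edge to the east edge (this pipe passes southeast of the tile); a crossing
tile connects west to east and south to north. -/
structure PipeDream (n : ℕ) where
  cross : ℕ → ℕ → Bool
  inShape : ∀ r c : ℕ, cross r c = true → r + c + 2 ≤ n

namespace PipeDream

variable {n : ℕ}

/-- `(P.pipes r c).1` is the label of the pipe entering box `(r, c)` from the west,
and `(P.pipes r c).2` is the label of the pipe entering box `(r, c)` from the south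
(junk value `0` if there is no box below box `(r, c)` in the triangular shape). -/
def pipes (P : PipeDream n) : ℕ → ℕ → ℕ × ℕ
  | r, c =>
    (if hc : c = 0 then r
      else if P.cross r (c - 1) then (pipes P r (c - 1)).1 else (pipes P r (c - 1)).2,
     if hr : r + c + 2 ≤ n then
        if P.cross (r + 1) c then (pipes P (r + 1) c).2 else (pipes P (r + 1) c).1
      else 0)
  termination_by r c => (n - r) + c
  decreasing_by all_goals omega

/-- The pipe entering box `(r, c)` from the west (travelling eastwards). -/
def west (P : PipeDream n) (r c : ℕ) : ℕ := (pipes P r c).1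

/-- The pipe entering box `(r, c)` from the south (travelling northwards). -/
def south (P : PipeDream n) (r c : ℕ) : ℕ := (pipes P r c).2

/-- The pipe exiting on the top side at column `c`. -/
def exitPipe (P : PipeDream n) (c : ℕ) : ℕ :=
  if P.cross 0 c then P.south 0 c else P.west 0 c

/-- `P` has exit permutation `ω`, i.e. the pipe exiting at column `c` is `ω c`;
equivalently, pipe `k` exits at column `ω⁻¹ k`. -/
def HasExitPerm (P : PipeDream n) (ω : Equiv.Perm (Fin n)) : Prop :=
  ∀ c : Fin n, P.exitPipe c.val = (ω c).val

/-- `P` is reduced: any two of its pipes cross at most once. -/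
def Reduced (P : PipeDream n) : Prop :=
  ∀ r c r' c' : ℕ, P.cross r c = true → P.cross r' c' = true → (r, c) ≠ (r', c') →
    ¬ ((P.west r c = P.west r' c' ∧ P.south r c = P.south r' c') ∨
        (P.west r c = P.south r' c' ∧ P.south r c = P.west r' c'))

/-- The arcs of the contact graph `P♯` of `P`: there is one arc for each elbow
contact of `P` (an elbow tile in a full box of the triangular shape), oriented from
the pipe passing northwest of the contact (the one travelling west-to-north) to the
pipe passing southeast of it (the one travelling south-to-east). -/
def Arc (P : PipeDream n) (i j : ℕ) : Prop :=
  ∃ r c : ℕ, r + c + 2 ≤ n ∧ P.cross r c = false ∧ P.west r c = i ∧ P.south r c = j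

/-- `P` is acyclic: its contact graph has no directed cycle. -/
def Acyclic (P : PipeDream n) : Prop := ∀ i : ℕ, ¬ Relation.TransGen P.Arc i i

/-- `i ⪯_P j` : there is a directed path (possibly empty) from `i` to `j` in the
contact graph of `P`. -/
def Path (P : PipeDream n) (i j : ℕ) : Prop := Relation.ReflTransGen P.Arc i j

/-- `π` is a linear extension of `P` : `π⁻¹ i < π⁻¹ j` for every arc `i → j` of the
contact graph of `P`. -/
def LinExt (P : PipeDream n) (π : Equiv.Perm (Fin n)) : Prop :=
  ∀ i j : Fin n, P.Arc i.val j.val → π⁻¹ i < π⁻¹ j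

/-- There is a contact (an elbow tile in a full box) between pipes `i` and `j`
at box `b`. -/
def ContactAt (P : PipeDream n) (i j : ℕ) (b : ℕ × ℕ) : Prop :=
  b.1 + b.2 + 2 ≤ n ∧ P.cross b.1 b.2 = false ∧
    ((P.west b.1 b.2 = i ∧ P.south b.1 b.2 = j) ∨
      (P.west b.1 b.2 = j ∧ P.south b.1 b.2 = i))

/-- `P'` is obtained from `P` by the flip exchanging the contact at box `b` with the
crossing at box `b'` (a contact and a crossing between the same two pipes). -/
def IsFlip (P P' : PipeDream n) (b b' : ℕ × ℕ) : Prop :=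
  b ≠ b' ∧
  P.cross b.1 b.2 = false ∧ P.cross b'.1 b'.2 = true ∧
  P'.cross b.1 b.2 = true ∧ P'.cross b'.1 b'.2 = false ∧
  (∀ r c : ℕ, (r, c) ≠ b → (r, c) ≠ b' → P.cross r c = P'.cross r c) ∧
  ((P.west b.1 b.2 = P.west b'.1 b'.2 ∧ P.south b.1 b.2 = P.south b'.1 b'.2) ∨
    (P.west b.1 b.2 = P.south b'.1 b'.2 ∧ P.south b.1 b.2 = P.west b'.1 b'.2))

/-- There is an increasing flip from `P` to `P'`: a flip exchanging a contact at a
box `b` weakly southwest of the box `b'` of the corresponding crossing. -/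
def IncFlip (P P' : PipeDream n) : Prop :=
  ∃ b b' : ℕ × ℕ, P.IsFlip P' b b' ∧ b'.1 ≤ b.1 ∧ b.2 ≤ b'.2

end PipeDream

/-- The weak order on permutations of `Fin n` : `π ≤ σ` if and only if
`Inv(π) ⊆ Inv(σ)`, where `Inv(π)` is the set of pairs `(i, j)` with `i < j` and
`π⁻¹ i > π⁻¹ j`. -/
def WeakLE {n : ℕ} (π σ : Equiv.Perm (Fin n)) : Prop :=
  ∀ i j : Fin n, i < j → π⁻¹ j < π⁻¹ i → σ⁻¹ j < σ⁻¹ i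

namespace PipeDream

variable {n : ℕ}

/-- label leaving box `(r,c)` through the north edge -/
def nOut (P : PipeDream n) (r c : ℕ) : ℕ := if P.cross r c then P.south r c else P.west r c

/-- label leaving box `(r,c)` through the east edge -/
def eOut (P : PipeDream n) (r c : ℕ) : ℕ := if P.cross r c then P.west r c else P.south r c

theorem west_zero (P : PipeDream n) (r : ℕ) : P.west r 0 = r := by
  unfold west; rw [pipes]; simp

theorem west_succ (P : PipeDream n) (r c : ℕ) : P.west r (c + 1) = P.eOut r c := by
  unfold west eOut; rw [pipes]; simp [west, south]

theorem south_eq (P : PipeDream n) (r c : ℕ) (h : r + c + 2 ≤ n) :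
    P.south r c = P.nOut (r + 1) c := by
  unfold south nOut; rw [pipes]; simp [west, south, h]

theorem nOut_cross (P : PipeDream n) {r c : ℕ} (h : P.cross r c = true) :
    P.nOut r c = P.south r c := by simp [nOut, h]
theorem eOut_cross (P : PipeDream n) {r c : ℕ} (h : P.cross r c = true) :
    P.eOut r c = P.west r c := by simp [eOut, h]
theorem nOut_elbow (P : PipeDream n) {r c : ℕ} (h : P.cross r c = false) :
    P.nOut r c = P.west r c := by simp [nOut, h]
theorem eOut_elbow (P : PipeDream n) {r c : ℕ} (h : P.cross r c = false) :
    P.eOut r c = P.south r c := by simp [eOut, h]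

/-- pipe `k` enters box `(r,c)` -/
def En (P : PipeDream n) (k r c : ℕ) : Prop :=
  (r + c + 1 ≤ n ∧ P.west r c = k) ∨ (r + c + 2 ≤ n ∧ P.south r c = k)

/-- pipe `i` enters box `(r,c)` and `k` is southeast of it on the same diagonal -/
def Ord (P : PipeDream n) (i k r c : ℕ) : Prop :=
  (r + c + 2 ≤ n ∧ P.west r c = i ∧ P.south r c = k) ∨
  (P.En i r c ∧ ∃ t, 1 ≤ t ∧ P.En k (r + t) (c + t))

theorem Ord.en {P : PipeDream n} {i k r c : ℕ} (h : P.Ord i k r c) : P.En i r c := by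
  rcases h with ⟨h1, h2, h3⟩ | ⟨h, _⟩
  · exact Or.inl ⟨by omega, h2⟩
  · exact h

theorem En.out {P : PipeDream n} {i r c : ℕ} (h : P.En i r c) :
    r + c + 1 ≤ n ∧ (P.nOut r c = i ∨ (r + c + 2 ≤ n ∧ P.eOut r c = i)) := by
  rcases h with ⟨h1, h2⟩ | ⟨h1, h2⟩
  · refine ⟨h1, ?_⟩
    cases hx : P.cross r c
    · left; rw [P.nOut_elbow hx, h2]
    · right; exact ⟨P.inShape _ _ hx, by rw [P.eOut_cross hx, h2]⟩
  · refine ⟨by omega, ?_⟩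
    cases hx : P.cross r c
    · right; exact ⟨h1, by rw [P.eOut_elbow hx, h2]⟩
    · left; rw [P.nOut_cross hx, h2]

theorem En.of_nOut {P : PipeDream n} {i r c : ℕ} (hn : r + c + 1 ≤ n) (h : P.nOut r c = i) :
    P.En i r c := by
  cases hx : P.cross r c
  · left; exact ⟨hn, by rw [← h, P.nOut_elbow hx]⟩
  · right; exact ⟨P.inShape _ _ hx, by rw [← h, P.nOut_cross hx]⟩

theorem En.of_eOut {P : PipeDream n} {i r c : ℕ} (hn : r + c + 2 ≤ n) (h : P.eOut r c = i) :
    P.En i r c := by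
  cases hx : P.cross r c
  · right; exact ⟨hn, by rw [← h, P.eOut_elbow hx]⟩
  · left; exact ⟨by omega, by rw [← h, P.eOut_cross hx]⟩

theorem En.next_e {P : PipeDream n} {i r c : ℕ} (hn : r + c + 2 ≤ n) (h : P.eOut r c = i) :
    P.En i r (c + 1) := Or.inl ⟨by omega, by rw [west_succ, h]⟩

theorem En.next_n {P : PipeDream n} {i r c : ℕ} (hn : r + 1 + c + 1 ≤ n)
    (h : P.nOut (r + 1) c = i) : P.En i r c :=
  Or.inr ⟨by omega, by rw [south_eq _ _ _ (by omega), h]⟩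

theorem En.exit {P : PipeDream n} {i : ℕ} : ∀ (m r c : ℕ), r + (n - c) ≤ m → P.En i r c →
    ∃ c', c' < n ∧ c ≤ c' + r ∧ P.exitPipe c' = i := by
  intro m
  induction m with
  | zero =>
    intro r c hm h
    have := h.out.1
    omega
  | succ m ih =>
    intro r c hm h
    obtain ⟨h1, h2 | ⟨h2, h3⟩⟩ := h.out
    · cases r with
      | zero => exact ⟨c, by omega, by omega, h2⟩
      | succ r =>
        obtain ⟨c', a, b, d⟩ := ih r c (by omega) (En.next_n h1 h2)
        exact ⟨c', a, by omega, d⟩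
    · obtain ⟨c', a, b, d⟩ := ih r (c + 1) (by omega) (En.next_e h2 h3)
      exact ⟨c', a, by omega, d⟩

theorem exit_inj {P : PipeDream n} {ω : Equiv.Perm (Fin n)} (hP : P.HasExitPerm ω) {c c' : ℕ}
    (hc : c < n) (hc' : c' < n) (h : P.exitPipe c = P.exitPipe c') : c = c' := by
  have h1 := hP ⟨c, hc⟩
  have h2 := hP ⟨c', hc'⟩
  simp only at h1 h2
  rw [h1, h2] at h
  have := ω.injective (Fin.ext h)
  simpa using this

/-- one forward step -/
theorem Ord.fwd {P : PipeDream n} {i k r c : ℕ} (h : P.Ord i k r c) :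
    (P.cross r c = true ∧ P.west r c = i ∧ P.south r c = k ∧ i ≠ k) ∨
    (r = 0 ∧ c < n ∧ P.exitPipe c = i ∧ ∃ r' c', c' = c + 1 + r' ∧ P.En k r' c') ∨
    (∃ r', r = r' + 1 ∧ P.Ord i k r' c) ∨ P.Ord i k r (c + 1) := by
  rcases h with ⟨h1, h2, h3⟩ | ⟨h1, t, ht, h2⟩
  · by_cases hx : P.cross r c = true ∧ i ≠ k
    · left; exact ⟨hx.1, h2, h3, hx.2⟩
    · right
      have hN : P.nOut r c = i := by
        unfold nOut; grind
      have hE : P.eOut r c = k := by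
        unfold eOut; grind
      cases r with
      | zero => left; exact ⟨rfl, by omega, hN, 0, c + 1, by omega, En.next_e h1 hE⟩
      | succ r =>
        right; left
        exact ⟨r, rfl, Or.inr ⟨En.next_n (by omega) hN, 1, le_rfl, En.next_e h1 hE⟩⟩
  · right
    obtain ⟨a1, a2⟩ := h1.out
    obtain ⟨b1, b2⟩ := h2.out
    obtain ⟨s, rfl⟩ : ∃ s, t = s + 1 := ⟨t - 1, by omega⟩
    rcases a2 with a2 | ⟨a2, a3⟩
    · cases r with
      | zero =>
        left
        refine ⟨rfl, by omega, a2, ?_⟩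
        rcases b2 with b2 | ⟨b2, b3⟩
        · exact ⟨0 + s, c + (s + 1), by omega, En.next_n (by omega) b2⟩
        · exact ⟨0 + (s + 1), c + (s + 1) + 1, by omega, En.next_e b2 b3⟩
      | succ r =>
        right; left
        refine ⟨r, rfl, Or.inr ⟨En.next_n (by omega) a2, ?_⟩⟩
        rcases b2 with b2 | ⟨b2, b3⟩
        · refine ⟨s + 1, by omega, ?_⟩
          have e : r + 1 + (s + 1) = r + (s + 1) + 1 := by omega
          rw [e] at b2
          exact En.next_n (by omega) b2
        · refine ⟨s + 2, by omega, ?_⟩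
          have := En.next_e b2 b3
          convert this using 1 <;> omega
    · right; right
      rcases b2 with b2 | ⟨b2, b3⟩
      · cases s with
        | zero =>
          left
          refine ⟨by omega, by rw [west_succ, a3], ?_⟩
          rw [south_eq _ _ _ (by omega)]
          exact b2
        | succ s =>
          right
          refine ⟨En.next_e a2 a3, s + 1, by omega, ?_⟩
          have := En.next_n (P := P) (r := r + (s + 1)) (c := c + (s + 1 + 1)) (by omega) b2
          convert this using 1 <;> omega
      · right
        refine ⟨En.next_e a2 a3, s + 1, by omega, ?_⟩
        have := En.next_e b2 b3
        convert this using 1 <;> omega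

theorem Ord.irrefl {P : PipeDream n} {ω : Equiv.Perm (Fin n)} (hP : P.HasExitPerm ω) {i : ℕ} :
    ∀ (m r c : ℕ), r + (n - c) ≤ m → ¬ P.Ord i i r c := by
  intro m
  induction m with
  | zero =>
    intro r c hm h
    have := h.en.out.1
    omega
  | succ m ih =>
    intro r c hm h
    have h0 := h.en.out.1
    rcases h.fwd with ⟨_, _, _, h⟩ | ⟨rfl, h1, h2, r', c', e, h3⟩ | ⟨r', rfl, hh⟩ | hh
    · exact h rfl
    · obtain ⟨c2, a, b, d⟩ := h3.exit _ _ _ le_rfl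
      have := exit_inj hP h1 a (h2.trans d.symm)
      omega
    · exact ih r' c (by omega) hh
    · exact ih r (c + 1) (by omega) hh

theorem En.box_unique {P : PipeDream n} {ω : Equiv.Perm (Fin n)} (hP : P.HasExitPerm ω)
    {i r c r' c' : ℕ} (h : P.En i r c) (h' : P.En i r' c') (e : c + r' = c' + r) :
    r = r' ∧ c = c' := by
  rcases lt_trichotomy r r' with hlt | heq | hgt
  · exfalso
    obtain ⟨t, rfl⟩ : ∃ t, r' = r + t := ⟨r' - r, by omega⟩
    obtain rfl : c' = c + t := by omega
    exact Ord.irrefl hP _ _ _ le_rfl (Or.inr ⟨h, t, by omega, h'⟩)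
  · omega
  · exfalso
    obtain ⟨t, rfl⟩ : ∃ t, r = r' + t := ⟨r - r', by omega⟩
    obtain rfl : c = c' + t := by omega
    exact Ord.irrefl hP _ _ _ le_rfl (Or.inr ⟨h', t, by omega, h⟩)

theorem west_ne_south {P : PipeDream n} {ω : Equiv.Perm (Fin n)} (hP : P.HasExitPerm ω)
    {r c : ℕ} (h : r + c + 2 ≤ n) : P.west r c ≠ P.south r c := by
  intro e
  exact Ord.irrefl hP _ _ _ le_rfl (Or.inl ⟨h, rfl, e.symm⟩)

/-- walking forward until pipe `i` reaches the box `(R,C)` -/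
theorem Ord.walk {P : PipeDream n} {ω : Equiv.Perm (Fin n)} (hP : P.HasExitPerm ω)
    {i k R C : ℕ} (hR : P.En i R C) : ∀ (m r c : ℕ), c + R + m = C + r → P.Ord i k r c →
    P.Ord i k R C ∨ ∃ x y, P.cross x y = true ∧ P.west x y = i ∧ P.south x y = k ∧
      c + x ≤ y + r ∧ y + R < C + x := by
  intro m
  induction m with
  | zero =>
    intro r c hm h
    obtain ⟨rfl, rfl⟩ := En.box_unique hP h.en hR (by omega)
    exact Or.inl h
  | succ m ih =>
    intro r c hm h
    rcases h.fwd with ⟨h1, h2, h3, h⟩ | ⟨rfl, h1, h2, r', c', e, h3⟩ | ⟨r', rfl, hh⟩ | hh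
    · right; exact ⟨r, c, h1, h2, h3, by omega, by omega⟩
    · exfalso
      obtain ⟨c2, a, b, d⟩ := hR.exit _ _ _ le_rfl
      have := exit_inj hP h1 a (h2.trans d.symm)
      omega
    · rcases ih r' c (by omega) hh with h | ⟨x, y, a1, a2, a3, a4, a5⟩
      · exact Or.inl h
      · exact Or.inr ⟨x, y, a1, a2, a3, by omega, by omega⟩
    · rcases ih r (c + 1) (by omega) hh with h | ⟨x, y, a1, a2, a3, a4, a5⟩
      · exact Or.inl h
      · exact Or.inr ⟨x, y, a1, a2, a3, by omega, by omega⟩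

/-- predecessor of an entering pipe -/
theorem En.pred {P : PipeDream n} {i r c : ℕ} (h : P.En i r c) :
    (c = 0 ∧ i = r) ∨ (∃ c', c = c' + 1 ∧ P.west r c = i ∧ r + c' + 2 ≤ n ∧ P.eOut r c' = i) ∨
    (r + c + 2 ≤ n ∧ P.south r c = i ∧ P.nOut (r + 1) c = i) := by
  rcases h with ⟨h1, h2⟩ | ⟨h1, h2⟩
  · cases c with
    | zero => left; rw [west_zero] at h2; exact ⟨rfl, h2.symm⟩
    | succ c => right; left; exact ⟨c, rfl, h2, by omega, by rw [← west_succ, h2]⟩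
  · right; right; exact ⟨h1, h2, by rw [← south_eq _ _ _ h1, h2]⟩

theorem En.label {P : PipeDream n} {i : ℕ} : ∀ (m r c : ℕ), (n - r) + c ≤ m → P.En i r c →
    r ≤ i + c := by
  intro m
  induction m with
  | zero =>
    intro r c hm h
    have := h.out.1
    omega
  | succ m ih =>
    intro r c hm h
    have h0 := h.out.1
    rcases h.pred with ⟨rfl, rfl⟩ | ⟨c', rfl, _, h1, h2⟩ | ⟨h1, _, h2⟩
    · omega
    · have := ih r c' (by omega) (En.of_eOut h1 h2)
      omega
    · have := ih (r + 1) c (by omega) (En.of_nOut (by omega) h2)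
      omega

/-- one backward step -/
theorem Ord.bwd {P : PipeDream n} {i k r c : ℕ} (h : P.Ord i k r c) :
    (c = 0 ∧ i = r) ∨
    (∃ x y, x + c = y + r + 1 ∧ P.cross x y = true ∧ P.west x y = k ∧ P.south x y = i) ∨
    (P.Ord i k (r + 1) c) ∨ ∃ c', c = c' + 1 ∧ P.Ord i k r c' := by
  rcases h with ⟨h1, h2, h3⟩ | ⟨h1, t, ht, h2⟩
  · cases c with
    | zero => left; rw [west_zero] at h2; exact ⟨rfl, h2.symm⟩
    | succ c =>
      right; right; right
      rw [west_succ] at h2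
      rw [south_eq _ _ _ h1] at h3
      exact ⟨c, rfl, Or.inr ⟨En.of_eOut (by omega) h2, 1, le_rfl, En.of_nOut (by omega) h3⟩⟩
  · obtain ⟨s, rfl⟩ : ∃ s, t = s + 1 := ⟨t - 1, by omega⟩
    rcases h1.pred with ⟨rfl, rfl⟩ | ⟨c', rfl, _, a1, a2⟩ | ⟨a1, _, a2⟩
    · left; exact ⟨rfl, rfl⟩
    · right; right; right
      refine ⟨c', rfl, Or.inr ⟨En.of_eOut a1 a2, ?_⟩⟩
      rcases h2.pred with ⟨b0, _⟩ | ⟨c2, e, _, b1, b2⟩ | ⟨b1, _, b2⟩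
      · omega
      · refine ⟨s + 1, by omega, ?_⟩
        obtain rfl : c2 = c' + (s + 1) := by omega
        exact En.of_eOut b1 b2
      · refine ⟨s + 2, by omega, ?_⟩
        have := En.of_nOut (by omega) b2
        convert this using 1 <;> omega
    · right
      rcases h2.pred with ⟨b0, _⟩ | ⟨c2, e, _, b1, b2⟩ | ⟨b1, _, b2⟩
      · omega
      · obtain rfl : c2 = c + s := by omega
        cases s with
        | zero =>
          simp only [Nat.zero_add, Nat.add_zero] at b1 b2
          cases hx : P.cross (r + 1) c
          · right; left; left
            rw [P.nOut_elbow hx] at a2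
            rw [P.eOut_elbow hx] at b2
            exact ⟨b1, a2, b2⟩
          · left
            rw [P.nOut_cross hx] at a2
            rw [P.eOut_cross hx] at b2
            exact ⟨r + 1, c, by omega, hx, b2, a2⟩
        | succ s =>
          right; left; right
          refine ⟨En.of_nOut (by omega) a2, s + 1, by omega, ?_⟩
          have := En.of_eOut b1 b2
          convert this using 1 <;> omega
      · right; left; right
        refine ⟨En.of_nOut (by omega) a2, s + 1, by omega, ?_⟩
        have := En.of_nOut (by omega) b2
        convert this using 1 <;> omega

/-- walking backward until pipe `i` reaches the box `(R,C)` -/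
theorem Ord.walk_back {P : PipeDream n} {ω : Equiv.Perm (Fin n)} (hP : P.HasExitPerm ω)
    {i k R C : ℕ} (hR : P.En i R C) : ∀ (m r c : ℕ), C + r + m = c + R → P.Ord i k r c →
    P.Ord i k R C ∨ ∃ x y, P.cross x y = true ∧ P.west x y = k ∧ P.south x y = i ∧
      y + r < c + x := by
  intro m
  induction m with
  | zero =>
    intro r c hm h
    obtain ⟨rfl, rfl⟩ := En.box_unique hP h.en hR (by omega)
    exact Or.inl h
  | succ m ih =>
    intro r c hm h
    rcases h.bwd with ⟨rfl, rfl⟩ | ⟨x, y, e, h1, h2, h3⟩ | hh | ⟨c', rfl, hh⟩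
    · have := hR.label _ _ _ le_rfl
      omega
    · right; exact ⟨x, y, h1, h2, h3, by omega⟩
    · rcases ih (r + 1) c (by omega) hh with h | ⟨x, y, a1, a2, a3, a4⟩
      · exact Or.inl h
      · exact Or.inr ⟨x, y, a1, a2, a3, by omega⟩
    · rcases ih r c' (by omega) hh with h | ⟨x, y, a1, a2, a3, a4⟩
      · exact Or.inl h
      · exact Or.inr ⟨x, y, a1, a2, a3, by omega⟩

/-! ### Elbows weakly northwest of each other -/

theorem row_cross (P : PipeDream n) (r c : ℕ) : ∀ m, (∀ x, c ≤ x → x < c + m →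
    P.cross r x = true) → P.west r (c + m) = P.west r c := by
  intro m
  induction m with
  | zero => intro _; rfl
  | succ m ih =>
    intro h
    rw [← add_assoc, west_succ, P.eOut_cross (h _ (by omega) (by omega))]
    exact ih (fun x h1 h2 => h x h1 (by omega))

theorem col_cross (P : PipeDream n) (r c : ℕ) : ∀ m, r + m + c + 2 ≤ n → (∀ x, r < x → x ≤ r + m →
    P.cross x c = true) → P.south (r + m) c = P.south r c := by
  intro m
  induction m with
  | zero => intro _ _; rfl
  | succ m ih =>
    intro hn h
    have := h (r + m + 1) (by omega) (by omega)
    rw [← ih (by omega) (fun x h1 h2 => h x h1 (by omega)), south_eq P (r + m) c (by omega),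
      P.nOut_cross this]
    rfl

theorem elbow_path {P : PipeDream n} (hred : P.Reduced) : ∀ (m r c p q : ℕ), p + q ≤ m →
    1 ≤ p + q → P.cross r c = false → P.cross (r + p) (c + q) = false → r + p + (c + q) + 1 ≤ n →
    Relation.ReflTransGen P.Arc (P.south r c) (P.west (r + p) (c + q)) := by
  intro m
  induction m with
  | zero => intro r c p q h1 h2; omega
  | succ m ih =>
    intro r c p q hm hpos he hf hn
    by_cases hg : ∃ a b, a ≤ p ∧ b ≤ q ∧ 1 ≤ a + b ∧ a + b < p + q ∧
        P.cross (r + a) (c + b) = false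
    · obtain ⟨a, b, h1, h2, h3, h4, h5⟩ := hg
      have A := ih r c a b (by omega) h3 he h5 (by omega)
      obtain ⟨p', rfl⟩ : ∃ p', p = a + p' := ⟨p - a, by omega⟩
      obtain ⟨q', rfl⟩ : ∃ q', q = b + q' := ⟨q - b, by omega⟩
      rw [← add_assoc, ← add_assoc] at hf ⊢
      have B := ih (r + a) (c + b) p' q' (by omega) (by omega) h5 hf (by omega)
      refine (A.tail ?_).trans B
      exact ⟨r + a, c + b, by omega, h5, rfl, rfl⟩
    · have hx : ∀ x y, r ≤ x → x ≤ r + p → c ≤ y → y ≤ c + q → r + c < x + y →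
          x + y < r + p + (c + q) → P.cross x y = true := by
        intro x y h1 h2 h3 h4 h5 h6
        by_contra hne
        apply hg
        refine ⟨x - r, y - c, by omega, by omega, by omega, by omega, ?_⟩
        have e1 : r + (x - r) = x := by omega
        have e2 : c + (y - c) = y := by omega
        rw [e1, e2]
        simpa using hne
      rcases Nat.eq_zero_or_pos p with rfl | hp
      · obtain ⟨q, rfl⟩ : ∃ q', q = q' + 1 := ⟨q - 1, by omega⟩
        have : P.west (r + 0) (c + (q + 1)) = P.south r c := by
          have h := row_cross P r (c + 1) q
            (fun x h1 h2 => hx r x (by omega) (by omega) (by omega) (by omega) (by omega) (by omega))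
          rw [west_succ, P.eOut_elbow he] at h
          rw [← h]; congr 1; omega
        rw [this]
      · obtain ⟨p, rfl⟩ : ∃ p', p = p' + 1 := ⟨p - 1, by omega⟩
        rcases Nat.eq_zero_or_pos q with rfl | hq
        · have : P.west (r + (p + 1)) (c + 0) = P.south r c := by
            have h := col_cross P r c p (by omega)
              (fun x h1 h2 => hx x c (by omega) (by omega) (by omega) (by omega) (by omega) (by omega))
            rw [south_eq P _ _ (by omega)] at h
            exact (P.nOut_elbow hf).symm.trans h
          rw [this]
        · obtain ⟨q, rfl⟩ : ∃ q', q = q' + 1 := ⟨q - 1, by omega⟩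
          exfalso
          have c1 := hx r (c + (q + 1)) (by omega) (by omega) (by omega) (by omega) (by omega)
            (by omega)
          have c2 := hx (r + (p + 1)) c (by omega) (by omega) (by omega) (by omega) (by omega)
            (by omega)
          have w1 : P.west r (c + (q + 1)) = P.south r c := by
            have h := row_cross P r (c + 1) q
              (fun x h1 h2 => hx r x (by omega) (by omega) (by omega) (by omega) (by omega)
                (by omega))
            rw [west_succ, P.eOut_elbow he] at h
            rw [← h]; congr 1; omega
          have s1 : P.south r (c + (q + 1)) = P.west (r + (p + 1)) (c + (q + 1)) := by
            have h := col_cross P r (c + (q + 1)) p (by omega)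
              (fun x h1 h2 => hx x (c + (q + 1)) (by omega) (by omega) (by omega) (by omega)
                (by omega) (by omega))
            rw [south_eq P (r + p) _ (by omega)] at h
            exact ((P.nOut_elbow hf).symm.trans h).symm
          have s2 : P.south (r + (p + 1)) c = P.south r c :=
            col_cross P r c (p + 1) (by omega)
              (fun x h1 h2 => hx x c (by omega) (by omega) (by omega) (by omega)
                (by omega) (by omega))
          have w2 : P.west (r + (p + 1)) (c + (q + 1)) = P.west (r + (p + 1)) c :=
            row_cross P (r + (p + 1)) c (q + 1)
              (fun x h1 h2 => hx (r + (p + 1)) x (by omega) (by omega) (by omega) (by omega)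
                (by omega) (by omega))
          refine hred _ _ _ _ c1 c2 ?_ (Or.inr ⟨w1.trans s2.symm, s1.trans w2⟩)
          simp

theorem west_elbow (P : PipeDream n) : ∀ (m r c : ℕ), n - (r + c) ≤ m → r + c + 1 ≤ n →
    ∃ c', c ≤ c' ∧ r + c' + 1 ≤ n ∧ P.cross r c' = false ∧ P.west r c' = P.west r c := by
  intro m
  induction m with
  | zero => intro r c h1 h2; omega
  | succ m ih =>
    intro r c h1 h2
    cases hx : P.cross r c
    · exact ⟨c, le_rfl, h2, hx, rfl⟩
    · have := P.inShape _ _ hx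
      obtain ⟨c', a, b, d, e⟩ := ih r (c + 1) (by omega) (by omega)
      rw [west_succ, P.eOut_cross hx] at e
      exact ⟨c', by omega, b, d, e⟩

theorem south_elbow (P : PipeDream n) : ∀ (m r c : ℕ), n - (r + c) ≤ m → r + c + 2 ≤ n →
    ∃ r', r < r' ∧ r' + c + 1 ≤ n ∧ P.cross r' c = false ∧ P.west r' c = P.south r c := by
  intro m
  induction m with
  | zero => intro r c h1 h2; omega
  | succ m ih =>
    intro r c h1 h2
    rw [south_eq _ _ _ h2]
    cases hx : P.cross (r + 1) c
    · rw [P.nOut_elbow hx]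
      exact ⟨r + 1, by omega, by omega, hx, rfl⟩
    · have := P.inShape _ _ hx
      obtain ⟨r', a, b, d, e⟩ := ih (r + 1) c (by omega) (by omega)
      rw [P.nOut_cross hx]
      exact ⟨r', by omega, b, d, e⟩

theorem se_path {P : PipeDream n} (hred : P.Reduced) {r c t k : ℕ} (he : P.cross r c = false)
    (ht : 1 ≤ t) (hk : P.En k (r + t) (c + t)) :
    Relation.ReflTransGen P.Arc (P.south r c) k := by
  rcases hk with ⟨h1, h2⟩ | ⟨h1, h2⟩
  · obtain ⟨c', a, b, d, e⟩ := west_elbow P _ _ _ le_rfl h1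
    obtain ⟨q, rfl⟩ : ∃ q, c' = c + q := ⟨c' - c, by omega⟩
    rw [← h2, ← e]
    exact elbow_path hred _ _ _ _ _ le_rfl (by omega) he d (by omega)
  · obtain ⟨r', a, b, d, e⟩ := south_elbow P _ _ _ le_rfl h1
    obtain ⟨q, rfl⟩ : ∃ q, r' = r + q := ⟨r' - r, by omega⟩
    rw [← h2, ← e]
    exact elbow_path hred _ _ _ _ _ le_rfl (by omega) he d (by omega)

/-! ### Labels after a flip -/

/-- `P` and `P'` differ exactly in boxes `(r,c)` and `(r',c')`, where pipes `i` and `j`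
of `P` meet, the first one being strictly before the second. -/
structure Sw (P P' : PipeDream n) (i j r c r' c' : ℕ) : Prop where
  lt : c + r' < c' + r
  full : r + c + 2 ≤ n
  full' : r' + c' + 2 ≤ n
  d1 : P'.cross r c = !P.cross r c
  d2 : P'.cross r' c' = !P.cross r' c'
  same : ∀ x y, (x, y) ≠ (r, c) → (x, y) ≠ (r', c') → P.cross x y = P'.cross x y
  m1 : (P.west r c = i ∧ P.south r c = j) ∨ (P.west r c = j ∧ P.south r c = i)
  m2 : (P.west r' c' = i ∧ P.south r' c' = j) ∨ (P.west r' c' = j ∧ P.south r' c' = i)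

/-- label transformation on the diagonal of `(x,y)` -/
def tw (i j r c r' c' x y : ℕ) (k : ℕ) : ℕ :=
  if c + x < y + r ∧ y + r' ≤ c' + x then Equiv.swap i j k else k

theorem tw_succ (i j r c r' c' x y k : ℕ) :
    tw i j r c r' c' x (y + 1) k =
      if c + x ≤ y + r ∧ y + r' < c' + x then Equiv.swap i j k else k := by
  unfold tw
  congr 1
  apply propext
  omega

theorem tw_up (i j r c r' c' x y k : ℕ) :
    tw i j r c r' c' x y k =
      if c + (x + 1) ≤ y + r ∧ y + r' < c' + (x + 1) then Equiv.swap i j k else k := by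
  unfold tw
  congr 1
  apply propext
  omega

theorem Sw.en {P P' : PipeDream n} {i j r c r' c' : ℕ} (S : Sw P P' i j r c r' c') :
    P.En i r c ∧ P.En j r c ∧ P.En i r' c' ∧ P.En j r' c' := by
  have h1 := S.full
  have h2 := S.full'
  unfold En
  rcases S.m1 with a | a <;> rcases S.m2 with b | b <;>
    refine ⟨?_, ?_, ?_, ?_⟩ <;> (first | (left; exact ⟨by omega, by tauto⟩) | (right; exact ⟨by omega, by tauto⟩))

/-- outgoing labels from incoming labels -/
theorem Sw.out {P P' : PipeDream n} {ω : Equiv.Perm (Fin n)} (hP : P.HasExitPerm ω)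
    {i j r c r' c' : ℕ} (S : Sw P P' i j r c r' c') {x y : ℕ}
    (hx : x + y + 1 ≤ n)
    (hw : P'.west x y = tw i j r c r' c' x y (P.west x y))
    (hs : x + y + 2 ≤ n → P'.south x y = tw i j r c r' c' x y (P.south x y)) :
    (P'.nOut x y = if c + x ≤ y + r ∧ y + r' < c' + x then Equiv.swap i j (P.nOut x y)
      else P.nOut x y) ∧
    (x + y + 2 ≤ n → P'.eOut x y = if c + x ≤ y + r ∧ y + r' < c' + x then
      Equiv.swap i j (P.eOut x y) else P.eOut x y) := by
  obtain ⟨e1, e2, e3, e4⟩ := S.en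
  have lt := S.lt
  by_cases hb : (x, y) = (r, c)
  · obtain ⟨rfl, rfl⟩ := Prod.mk.inj hb
    have hs := hs S.full
    have t : ∀ k, tw i j x y r' c' x y k = k := by intro k; simp [tw]
    rw [t] at hw hs
    have hc : y + x ≤ y + x ∧ y + r' < c' + x := ⟨le_rfl, lt⟩
    rw [if_pos hc, if_pos hc]
    unfold nOut eOut
    rw [S.d1, hw, hs]
    rcases S.m1 with ⟨a, b⟩ | ⟨a, b⟩ <;> rw [a, b] <;> cases P.cross x y <;> simp
  by_cases hb' : (x, y) = (r', c')
  · obtain ⟨rfl, rfl⟩ := Prod.mk.inj hb'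
    have hs := hs S.full'
    have t : ∀ k, tw i j r c x y x y k = Equiv.swap i j k := by intro k; simp [tw, lt]
    rw [t] at hw hs
    have hc : ¬ (c + x ≤ y + r ∧ y + x < y + x) := by omega
    rw [if_neg hc, if_neg hc]
    unfold nOut eOut
    rw [S.d2, hw, hs]
    rcases S.m2 with ⟨a, b⟩ | ⟨a, b⟩ <;> rw [a, b] <;> cases P.cross x y <;> simp
  have hsame := S.same x y hb hb'
  have fix : (y + r = c + x ∨ y + r' = c' + x) → ∀ k, P.En k x y → Equiv.swap i j k = k := by
    intro hd k hk
    apply Equiv.swap_apply_of_ne_of_ne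
    · rintro rfl
      rcases hd with hd | hd
      · have := hk.box_unique hP e1 (by omega)
        exact hb (Prod.ext this.1 this.2)
      · have := hk.box_unique hP e3 (by omega)
        exact hb' (Prod.ext this.1 this.2)
    · rintro rfl
      rcases hd with hd | hd
      · have := hk.box_unique hP e2 (by omega)
        exact hb (Prod.ext this.1 this.2)
      · have := hk.box_unique hP e4 (by omega)
        exact hb' (Prod.ext this.1 this.2)
  have key : ∀ k, P.En k x y → tw i j r c r' c' x y k =
      if c + x ≤ y + r ∧ y + r' < c' + x then Equiv.swap i j k else k := by
    intro k hk
    unfold tw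
    by_cases hd : y + r = c + x ∨ y + r' = c' + x
    · rw [fix hd k hk]; simp
    · congr 1
      apply propext
      omega
  constructor
  · rw [← key _ (En.of_nOut hx rfl)]
    unfold nOut
    rw [← hsame]
    cases hcr : P.cross x y
    · simpa using hw
    · simpa using hs (P.inShape _ _ hcr)
  · intro hfull
    rw [← key _ (En.of_eOut hfull rfl)]
    unfold eOut
    rw [← hsame]
    cases hcr : P.cross x y
    · simpa using hs hfull
    · simpa using hw

theorem Sw.labels {P P' : PipeDream n} {ω : Equiv.Perm (Fin n)} (hP : P.HasExitPerm ω)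
    {i j r c r' c' : ℕ} (S : Sw P P' i j r c r' c') : ∀ (m x y : ℕ), (n - x) + y ≤ m →
    x + y + 1 ≤ n →
    P'.west x y = tw i j r c r' c' x y (P.west x y) ∧
    (x + y + 2 ≤ n → P'.south x y = tw i j r c r' c' x y (P.south x y)) := by
  intro m
  induction m with
  | zero => intro x y h1 h2; omega
  | succ m ih =>
    intro x y h1 h2
    constructor
    · cases y with
      | zero =>
        rw [west_zero, west_zero]
        unfold tw
        split_ifs with h
        · obtain ⟨e1, e2, _, _⟩ := S.en
          have l1 := e1.label _ _ _ le_rfl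
          have l2 := e2.label _ _ _ le_rfl
          rw [Equiv.swap_apply_of_ne_of_ne] <;> omega
        · rfl
      | succ y =>
        obtain ⟨a, b⟩ := ih x y (by omega) (by omega)
        rw [west_succ, west_succ, tw_succ]
        exact (S.out hP (by omega) a b).2 (by omega)
    · intro h3
      obtain ⟨a, b⟩ := ih (x + 1) y (by omega) (by omega)
      rw [south_eq _ _ _ h3, south_eq _ _ _ h3, tw_up]
      exact (S.out hP (by omega) a b).1

theorem Sw.symm {P P' : PipeDream n} {ω : Equiv.Perm (Fin n)} (hP : P.HasExitPerm ω)
    {i j r c r' c' : ℕ} (S : Sw P P' i j r c r' c') : Sw P' P i j r c r' c' := by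
  have h1 := S.full
  have h2 := S.full'
  have lt := S.lt
  refine ⟨S.lt, h1, h2, by rw [S.d1]; simp, by rw [S.d2]; simp,
    fun x y a b => (S.same x y a b).symm, ?_, ?_⟩
  · obtain ⟨a, b⟩ := S.labels hP _ r c le_rfl (by omega)
    rw [a, b h1]
    have t : ∀ k, tw i j r c r' c' r c k = k := by intro k; simp [tw]
    rw [t, t]
    exact S.m1
  · obtain ⟨a, b⟩ := S.labels hP _ r' c' le_rfl (by omega)
    rw [a, b h2]
    have t : ∀ k, tw i j r c r' c' r' c' k = Equiv.swap i j k := by intro k; simp [tw, lt]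
    rw [t, t]
    rcases S.m2 with ⟨a, b⟩ | ⟨a, b⟩ <;> rw [a, b] <;> simp

/-! ### Abstract argument -/

section abstr

open Relation

theorem transport {R R' : ℕ → ℕ → Prop} {i j : ℕ}
    (hac : ∀ x, ¬ TransGen R x x)
    (H0 : ∀ u v, u ≠ i → u ≠ j → v ≠ i → v ≠ j → R u v → R' u v)
    {a b : ℕ} (hab : (a = i ∧ b = j) ∨ (a = j ∧ b = i))
    {k m : ℕ} (h1 : TransGen R a k) (h : ReflTransGen R k m) : TransGen R m b →
    ReflTransGen R' k m := by
  have ne : ∀ v, TransGen R a v → TransGen R v b → v ≠ i ∧ v ≠ j := by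
    intro v h1 h2
    have x1 : v ≠ a := by rintro rfl; exact hac _ h1
    have x2 : v ≠ b := by rintro rfl; exact hac _ h2
    rcases hab with ⟨rfl, rfl⟩ | ⟨rfl, rfl⟩
    · exact ⟨x1, x2⟩
    · exact ⟨x2, x1⟩
  induction h with
  | refl => intro _; exact .refl
  | @tail u v hu huv ih =>
    intro hv
    have hu' : TransGen R u b := TransGen.head huv hv
    have au : TransGen R a u := h1.trans_left hu
    have := ne u au hu'
    have hv' := ne v (au.tail huv) hv
    exact (ih hu').tail (H0 _ _ this.1 this.2 hv'.1 hv'.2 huv)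

theorem abstract_main {R R' : ℕ → ℕ → Prop} {i j : ℕ}
    (hac : ∀ x, ¬ TransGen R x x) (hac' : ∀ x, ¬ TransGen R' x x)
    (H0 : ∀ u v, u ≠ i → u ≠ j → v ≠ i → v ≠ j → (R u v ↔ R' u v))
    (H1 : ∀ k, k ≠ i → k ≠ j → R i k → R' i k ∨
      (R' j k ∧ (ReflTransGen R j k ∨ ReflTransGen R' i k)))
    (H1' : ∀ k, k ≠ i → k ≠ j → R' j k → R j k ∨ R i k)
    (H2 : ∀ k, k ≠ i → k ≠ j → R k j → R' k j ∨ R' k i)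
    (H2' : ∀ k, k ≠ i → k ≠ j → R' k i → R k i ∨ R k j)
    (H3 : R i j) (H3' : R' j i) :
    (∀ k, R i k → ¬ TransGen R k j) ∧ (¬ TransGen R j i) ∧
    (¬ TransGen R' i j) ∧ (∀ k, R' j k → ¬ TransGen R' k i) := by
  have A : ∀ k, R i k → ¬ TransGen R k j := by
    intro k hik hkj
    obtain ⟨m, hkm, hmj⟩ := TransGen.tail'_iff.1 hkj
    have im : TransGen R i m := (TransGen.single hik).trans_left hkm
    have k1 : k ≠ i := by rintro rfl; exact hac _ (.single hik)
    have k2 : k ≠ j := by rintro rfl; exact hac _ hkj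
    have m1 : m ≠ i := by rintro rfl; exact hac _ im
    have m2 : m ≠ j := by rintro rfl; exact hac _ (.single hmj)
    have hkm' : ReflTransGen R' k m :=
      transport hac (fun u v a b c d => (H0 u v a b c d).1) (Or.inl ⟨rfl, rfl⟩)
        (.single hik) hkm (.single hmj)
    rcases H1 k k1 k2 hik with a | ⟨a, b⟩
    · have a' : TransGen R' i m := (TransGen.single a).trans_left hkm'
      rcases H2 m m1 m2 hmj with d | d
      · exact hac' _ ((a'.tail d).tail H3')
      · exact hac' _ (a'.tail d)
    · have a' : TransGen R' j m := (TransGen.single a).trans_left hkm'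
      rcases H2 m m1 m2 hmj with d | d
      · exact hac' _ (a'.tail d)
      · rcases b with b | b
        · exact hac _ (TransGen.tail' (b.trans hkm) hmj)
        · exact hac' _ (TransGen.tail' (b.trans hkm') d)
  refine ⟨A, fun h => hac _ (h.tail H3), fun h => hac' _ (h.tail H3'), ?_⟩
  intro k hik hkj
  obtain ⟨m, hkm, hmj⟩ := TransGen.tail'_iff.1 hkj
  have im : TransGen R' j m := (TransGen.single hik).trans_left hkm
  have k1 : k ≠ j := by rintro rfl; exact hac' _ (.single hik)
  have k2 : k ≠ i := by rintro rfl; exact hac' _ hkj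
  have m1 : m ≠ j := by rintro rfl; exact hac' _ im
  have m2 : m ≠ i := by rintro rfl; exact hac' _ (.single hmj)
  have hkm' : ReflTransGen R k m :=
    transport hac' (fun u v a b c d => (H0 u v a b c d).2) (Or.inr ⟨rfl, rfl⟩)
      (.single hik) hkm (.single hmj)
  rcases H1' k k2 k1 hik with a | a
  · have a' : TransGen R j m := (TransGen.single a).trans_left hkm'
    rcases H2' m m2 m1 hmj with d | d
    · exact hac _ ((a'.tail d).tail H3)
    · exact hac _ (a'.tail d)
  · have a' : TransGen R i m := (TransGen.single a).trans_left hkm'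
    rcases H2' m m2 m1 hmj with d | d
    · exact hac _ (a'.tail d)
    · exact A k a (TransGen.tail' hkm' d)

end abstr

/-! ### The main lemma -/

theorem tw_cases (i j r c r' c' x y k : ℕ) :
    tw i j r c r' c' x y k = k ∨ tw i j r c r' c' x y k = Equiv.swap i j k := by
  unfold tw; split_ifs <;> simp

theorem tw_of_ne {i j r c r' c' x y k : ℕ} (h1 : k ≠ i) (h2 : k ≠ j) :
    tw i j r c r' c' x y k = k := by
  unfold tw; rw [Equiv.swap_apply_of_ne_of_ne h1 h2]; simp

theorem Sw.arc {P P' : PipeDream n} {ω : Equiv.Perm (Fin n)} (hP : P.HasExitPerm ω)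
    {i j r c r' c' : ℕ} (S : Sw P P' i j r c r' c') {x y u v : ℕ} (hn : x + y + 2 ≤ n)
    (hc : P.cross x y = false) (hu : P.west x y = u) (hv : P.south x y = v)
    (hne : (u ≠ i ∧ u ≠ j) ∨ (v ≠ i ∧ v ≠ j)) :
    P'.cross x y = false ∧ P'.west x y = tw i j r c r' c' x y u ∧
      P'.south x y = tw i j r c r' c' x y v := by
  obtain ⟨a, b⟩ := S.labels hP _ x y le_rfl (by omega)
  refine ⟨?_, by rw [a, hu], by rw [b hn, hv]⟩
  rw [← S.same x y, hc]
  · intro e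
    obtain ⟨rfl, rfl⟩ := Prod.mk.inj e
    rcases S.m1 with h | h <;> omega
  · intro e
    obtain ⟨rfl, rfl⟩ := Prod.mk.inj e
    rcases S.m2 with h | h <;> omega

theorem Sw.main {P P' : PipeDream n} {ω : Equiv.Perm (Fin n)}
    (hred : P.Reduced) (hP : P.HasExitPerm ω) (hac : P.Acyclic)
    (hred' : P'.Reduced) (hP' : P'.HasExitPerm ω) (hac' : P'.Acyclic)
    {i j r c r' c' : ℕ} (S : Sw P P' i j r c r' c') (hb : P.cross r c = false)
    (hb' : P.cross r' c' = true) (hi : P.west r c = i) (hj : P.south r c = j) :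
    (∀ k, P.Arc i k → ¬ Relation.TransGen P.Arc k j) ∧ (¬ Relation.TransGen P.Arc j i) ∧
    (¬ Relation.TransGen P'.Arc i j) ∧ (∀ k, P'.Arc j k → ¬ Relation.TransGen P'.Arc k i) := by
  have lt := S.lt
  have full := S.full
  have full' := S.full'
  obtain ⟨e1, e2, e3, e4⟩ := S.en
  have hij : i ≠ j := by rw [← hi, ← hj]; exact west_ne_south hP full
  have S' := S.symm hP
  -- orientation at the second box
  have or2 : P.west r' c' = i ∧ P.south r' c' = j := by
    rcases S.m2 with h | h
    · exact h
    · exfalso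
      rcases Ord.walk hP e3 (c' + r - (c + r')) r c (by omega) (Or.inl ⟨full, hi, hj⟩) with
        (⟨_, a, b⟩ | ⟨t0, t, ht, ho⟩) | ⟨x, y, a1, a2, a3, a4, a5⟩
      · exact hij (a.symm.trans h.1)
      · have := ho.box_unique hP e4 (by omega)
        omega
      · refine hred x y r' c' a1 hb' ?_ (Or.inr ⟨a2.trans h.2.symm, a3.trans h.1.symm⟩)
        intro e
        obtain ⟨rfl, rfl⟩ := Prod.mk.inj e
        omega
  have tswap : ∀ k, tw i j r c r' c' r' c' k = Equiv.swap i j k := by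
    intro k; simp [tw, lt]
  have lab2 : P'.west r' c' = j ∧ P'.south r' c' = i := by
    obtain ⟨a, b⟩ := S.labels hP _ r' c' le_rfl (by omega)
    rw [a, b full', or2.1, or2.2, tswap, tswap]
    simp
  have hel' : P'.cross r' c' = false := by rw [S.d2, hb']; rfl
  refine abstract_main hac hac' ?_ ?_ ?_ ?_ ?_ ?_ ?_
  · intro u v u1 u2 v1 v2
    constructor
    · rintro ⟨x, y, h1, h2, h3, h4⟩
      obtain ⟨a, b, d⟩ := S.arc hP h1 h2 h3 h4 (Or.inl ⟨u1, u2⟩)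
      rw [tw_of_ne u1 u2] at b
      rw [tw_of_ne v1 v2] at d
      exact ⟨x, y, h1, a, b, d⟩
    · rintro ⟨x, y, h1, h2, h3, h4⟩
      obtain ⟨a, b, d⟩ := S'.arc hP' h1 h2 h3 h4 (Or.inl ⟨u1, u2⟩)
      rw [tw_of_ne u1 u2] at b
      rw [tw_of_ne v1 v2] at d
      exact ⟨x, y, h1, a, b, d⟩
  · rintro k k1 k2 ⟨x, y, h1, h2, h3, h4⟩
    obtain ⟨a, b, d⟩ := S.arc hP h1 h2 h3 h4 (Or.inr ⟨k1, k2⟩)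
    rw [tw_of_ne k1 k2] at d
    by_cases hd : c + x < y + r ∧ y + r' ≤ c' + x
    · right
      have b' : P'.west x y = j := by rw [b, tw, if_pos hd]; simp
      refine ⟨⟨x, y, h1, a, b', d⟩, ?_⟩
      have hO : P.Ord i k x y := Or.inl ⟨h1, h3, h4⟩
      rcases Ord.walk_back hP e1 (y + r - (c + x)) x y (by omega) hO with
        (⟨_, f1, f2⟩ | ⟨_, t, ht, ho⟩) | ⟨p, q, f1, f2, f3, f4⟩
      · exact absurd (f2.symm.trans hj) k2
      · left
        rw [← hj]
        exact se_path hred hb ht ho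
      rcases Ord.walk hP e3 (c' + x - (y + r')) x y (by omega) hO with
        (⟨_, g1, g2⟩ | ⟨_, t, ht, ho⟩) | ⟨p', q', g1, g2, g3, g4, g5⟩
      · exact absurd (g2.symm.trans or2.2) k2
      · right
        rw [← lab2.2]
        refine se_path hred' hel' ht ?_
        have hn' := ho.out.1
        obtain ⟨w, s⟩ := S.labels hP _ (r' + t) (c' + t) le_rfl hn'
        rcases ho with ⟨o1, o2⟩ | ⟨o1, o2⟩
        · left; exact ⟨o1, by rw [w, o2, tw_of_ne k1 k2]⟩
        · right; exact ⟨o1, by rw [s o1, o2, tw_of_ne k1 k2]⟩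
      · exfalso
        refine hred p q p' q' f1 g1 ?_ (Or.inr ⟨f2.trans g3.symm, f3.trans g2.symm⟩)
        intro e
        obtain ⟨rfl, rfl⟩ := Prod.mk.inj e
        omega
    · left
      rw [tw, if_neg hd] at b
      exact ⟨x, y, h1, a, b, d⟩
  · rintro k k1 k2 ⟨x, y, h1, h2, h3, h4⟩
    obtain ⟨a, b, d⟩ := S'.arc hP' h1 h2 h3 h4 (Or.inr ⟨k1, k2⟩)
    rw [tw_of_ne k1 k2] at d
    rcases tw_cases i j r c r' c' x y j with e | e
    · rw [e] at b; left; exact ⟨x, y, h1, a, b, d⟩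
    · rw [e, Equiv.swap_apply_right] at b; right; exact ⟨x, y, h1, a, b, d⟩
  · rintro k k1 k2 ⟨x, y, h1, h2, h3, h4⟩
    obtain ⟨a, b, d⟩ := S.arc hP h1 h2 h3 h4 (Or.inl ⟨k1, k2⟩)
    rw [tw_of_ne k1 k2] at b
    rcases tw_cases i j r c r' c' x y j with e | e
    · rw [e] at d; left; exact ⟨x, y, h1, a, b, d⟩
    · rw [e, Equiv.swap_apply_right] at d; right; exact ⟨x, y, h1, a, b, d⟩
  · rintro k k1 k2 ⟨x, y, h1, h2, h3, h4⟩
    obtain ⟨a, b, d⟩ := S'.arc hP' h1 h2 h3 h4 (Or.inl ⟨k1, k2⟩)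
    rw [tw_of_ne k1 k2] at b
    rcases tw_cases i j r c r' c' x y i with e | e
    · rw [e] at d; left; exact ⟨x, y, h1, a, b, d⟩
    · rw [e, Equiv.swap_apply_left] at d; right; exact ⟨x, y, h1, a, b, d⟩
  · exact ⟨r, c, full, hb, hi, hj⟩
  · exact ⟨r', c', full', hel', lab2.1, lab2.2⟩

theorem chain_transGen {R : ℕ → ℕ → Prop} {b : ℕ} : ∀ (l : List ℕ) (a : ℕ),
    List.IsChain R (a :: (l ++ [b])) → Relation.TransGen R a b := by
  intro l
  induction l with
  | nil => intro a h; simp at h; exact .single h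
  | cons x l ih =>
    intro a h
    rw [List.cons_append, List.isChain_cons_cons] at h
    exact Relation.TransGen.head h.1 (ih x h.2)

theorem chain_nil_of {R : ℕ → ℕ → Prop} {a b : ℕ} (h : ∀ k, R a k → ¬ Relation.TransGen R k b)
    (l : List ℕ) (hl : List.Chain R a (l ++ [b])) : l = [] := by
  cases l with
  | nil => rfl
  | cons x l =>
    have hl : List.IsChain R (a :: (x :: l ++ [b])) := hl
    rw [List.cons_append, List.isChain_cons_cons] at hl
    exact absurd (chain_transGen l x hl.2) (h x hl.1)

theorem chain_nil_of' {R : ℕ → ℕ → Prop} {a b : ℕ} (h : ¬ Relation.TransGen R a b)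
    (l : List ℕ) (hl : List.Chain R a (l ++ [b])) : l = [] :=
  absurd (chain_transGen l a hl) h

theorem Sw.final {P P' : PipeDream n} {ω : Equiv.Perm (Fin n)}
    (hred : P.Reduced) (hP : P.HasExitPerm ω) (hac : P.Acyclic)
    (hred' : P'.Reduced) (hP' : P'.HasExitPerm ω) (hac' : P'.Acyclic)
    {i j r c r' c' : ℕ} (S : Sw P P' i j r c r' c') (hb : P.cross r c = false)
    (hb' : P.cross r' c' = true) :
    (∀ l : List ℕ, List.Chain P.Arc i (l ++ [j]) → l = []) ∧
    (∀ l : List ℕ, List.Chain P.Arc j (l ++ [i]) → l = []) ∧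
    (∀ l : List ℕ, List.Chain P'.Arc i (l ++ [j]) → l = []) ∧
    (∀ l : List ℕ, List.Chain P'.Arc j (l ++ [i]) → l = []) := by
  rcases S.m1 with ⟨h1, h2⟩ | ⟨h1, h2⟩
  · obtain ⟨a, b, d, e⟩ := S.main hred hP hac hred' hP' hac' hb hb' h1 h2
    exact ⟨chain_nil_of a, chain_nil_of' b, chain_nil_of' d, chain_nil_of e⟩
  · have S2 : Sw P P' j i r c r' c' := ⟨S.lt, S.full, S.full', S.d1, S.d2, S.same, S.m1.symm,
      S.m2.symm⟩
    obtain ⟨a, b, d, e⟩ := S2.main hred hP hac hred' hP' hac' hb hb' h1 h2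
    exact ⟨chain_nil_of' b, chain_nil_of a, chain_nil_of e, chain_nil_of' d⟩

end PipeDream

/-- Let `P, P' ∈ Π(ω)` be two acyclic reduced pipe dreams related
by the flip of a contact between their pipes `i` and `j`.  Then every directed path
between `i` and `j` (in either direction) in the contact graph `P♯`, and every
directed path between `i` and `j` in `P'♯`, consists of a single arc (any directed
path from one of `i, j` to the other has no intermediate vertices). -/
theorem flip_path_is_arc (n : ℕ) (ω : Equiv.Perm (Fin n)) (P P' : PipeDream n)
    (hred : P.Reduced) (hexit : P.HasExitPerm ω) (hacyclic : P.Acyclic)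
    (hred' : P'.Reduced) (hexit' : P'.HasExitPerm ω) (hacyclic' : P'.Acyclic)
    (i j : Fin n) (b b' : ℕ × ℕ)
    (hcontact : P.ContactAt i.val j.val b) (hflip : P.IsFlip P' b b') :
    (∀ l : List ℕ, List.Chain P.Arc i.val (l ++ [j.val]) → l = []) ∧
    (∀ l : List ℕ, List.Chain P.Arc j.val (l ++ [i.val]) → l = []) ∧
    (∀ l : List ℕ, List.Chain P'.Arc i.val (l ++ [j.val]) → l = []) ∧
    (∀ l : List ℕ, List.Chain P'.Arc j.val (l ++ [i.val]) → l = []) := by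
  obtain ⟨r, c⟩ := b
  obtain ⟨r', c'⟩ := b'
  obtain ⟨hne, f1, f2, f3, f4, f5, f6⟩ := hflip
  obtain ⟨g1, g2, g3⟩ := hcontact
  simp only at f1 f2 f3 f4 f5 f6 g1 g2 g3
  have full' := P.inShape _ _ f2
  have m2 : (P.west r' c' = i.val ∧ P.south r' c' = j.val) ∨
      (P.west r' c' = j.val ∧ P.south r' c' = i.val) := by omega
  have d1 : P'.cross r c = !P.cross r c := by rw [f1, f3]; rfl
  have d2 : P'.cross r' c' = !P.cross r' c' := by rw [f2, f4]; rfl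
  rcases lt_trichotomy (c + r') (c' + r) with h | h | h
  · have S : PipeDream.Sw P P' i.val j.val r c r' c' := ⟨h, g1, full', d1, d2, f5, g3, m2⟩
    exact S.final hred hexit hacyclic hred' hexit' hacyclic' f1 f2
  · exfalso
    have a : P.En i.val r c := by
      rcases g3 with ⟨x, y⟩ | ⟨x, y⟩
      · exact Or.inl ⟨by omega, x⟩
      · exact Or.inr ⟨by omega, y⟩
    have a' : P.En i.val r' c' := by
      rcases m2 with ⟨x, y⟩ | ⟨x, y⟩
      · exact Or.inl ⟨by omega, x⟩
      · exact Or.inr ⟨by omega, y⟩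
    have := a.box_unique hexit a' h
    exact hne (Prod.ext this.1 this.2)
  · have S : PipeDream.Sw P P' i.val j.val r' c' r c :=
      ⟨h, full', g1, d2, d1, fun x y p q => f5 x y q p, m2, g3⟩
    obtain ⟨p, q, s, t⟩ := (S.symm hexit).final hred' hexit' hacyclic' hred hexit hacyclic f4 f3
    exact ⟨s, t, p, q⟩
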